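/- Sparse Gaussian regime. Let α ∈ (0,1), β ∈ (0,1-α). Let 1/2 < δ < 1 and 0 < r < 1 with r > r*(δ), where r*(δ) = δ - 1/2 if 1/2 < δ < 3/4 and r*(δ) = (1-√(1-δ))² if 3/4 ≤ δ < 1. Let ε_n and τ_n be sequences with ε_n/n^{-δ} → 1 and τ_n/√(2r·log n) → 1 as n → ∞. For each n let X₁,…,Xₙ be i.i.d. with density f_n(x) = (1-ε_n)φ_G(x-μ₁) + ε_n φ_G(x-μ₂) where μ₂ - μ₁ = τ_n. Then, for n large enough, P_{f_n}(Ψ_α = 0) ≤ β. -/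

import Mathlib

open MeasureTheory Filter Set

noncomputable section

/-- The measure on `ℝ` with Lebesgue density `f`. -/
def pdfMeasure (f : ℝ → ℝ) : Measure ℝ :=
  MeasureTheory.volume.withDensity (fun x => ENNReal.ofReal (f x))

/-- The joint law of `n` i.i.d. observations with common density `f`. -/
def sampleMeasure (n : ℕ) (f : ℝ → ℝ) : Measure (Fin n → ℝ) :=
  Measure.pi (fun _ : Fin n => pdfMeasure f)

/-- The `k`-th order statistic (for `1 ≤ k ≤ n`) of the sample `ω`. -/
def oStat {n : ℕ} (k : ℕ) (ω : Fin n → ℝ) : ℝ :=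
  if h : 1 ≤ k ∧ k ≤ n then ω (Tuple.sort ω ⟨k - 1, by omega⟩) else 0

/-- The spacing `X_{(n-k+1)} - X_{(k)}` of the order statistics. -/
def spacing {n : ℕ} (k : ℕ) (ω : Fin n → ℝ) : ℝ :=
  oStat (n - k + 1) ω - oStat k ω

/-- `K_n = {2^j : 0 ≤ j ≤ ⌊log₂ (n/2)⌋}`. -/
def Kfin (n : ℕ) : Finset ℕ :=
  (Finset.range (Nat.log 2 (n / 2) + 1)).image (fun j => 2 ^ j)

/-- The `(1-u)`-quantile of the spacing `X_{(n-k+1)} - X_{(k)}` under the null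
hypothesis (sample of density `φ`; under `H₀` this law does not depend on the
translation parameter). -/
def spacingQuantile (n : ℕ) (φ : ℝ → ℝ) (u : ℝ) (k : ℕ) : ℝ :=
  sInf {t : ℝ | sampleMeasure n φ {ω | spacing k ω > t} ≤ ENNReal.ofReal u}

/-- The corrected level `α_n`. -/
def alphaN (n : ℕ) (φ : ℝ → ℝ) (α : ℝ) : ℝ :=
  sSup {u : ℝ | u ∈ Set.Ioo (0:ℝ) 1 ∧
    sampleMeasure n φ {ω | ∃ k ∈ Kfin n, spacing k ω > spacingQuantile n φ u k}
      ≤ ENNReal.ofReal α}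

/-- The rejection region of the multiple spacing test `Ψ_α`. -/
def psiReject (n : ℕ) (φ : ℝ → ℝ) (α : ℝ) : Set (Fin n → ℝ) :=
  {ω | ∃ k ∈ Kfin n, spacing k ω > spacingQuantile n φ (alphaN n φ α) k}

/-- The empirical (unbiased) variance `S_n²`. -/
def varStat {n : ℕ} (ω : Fin n → ℝ) : ℝ :=
  (∑ i, (ω i - (∑ j, ω j) / (n : ℝ)) ^ 2) / ((n : ℝ) - 1)

/-- The `(1-α)`-quantile of `S_n²` under the null hypothesis. -/
def varQuantile (n : ℕ) (φ : ℝ → ℝ) (α : ℝ) : ℝ :=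
  sInf {t : ℝ | sampleMeasure n φ {ω | varStat ω > t} ≤ ENNReal.ofReal α}

/-- The standard Gaussian density. -/
def phiG (x : ℝ) : ℝ := (Real.sqrt (2 * Real.pi))⁻¹ * Real.exp (-x ^ 2 / 2)

/-- A two-component Gaussian mixture density. -/
def mixG (ε μ₁ μ₂ : ℝ) : ℝ → ℝ := fun x => (1 - ε) * phiG (x - μ₁) + ε * phiG (x - μ₂)

/-- Survival function `Φ̄ = 1 - Φ` of the density `φ`. -/
def Phibar (φ : ℝ → ℝ) (u : ℝ) : ℝ := 1 - ∫ x in Set.Iic u, φ x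

/-- The standard Laplace density. -/
def phiL (x : ℝ) : ℝ := (1 / 2) * Real.exp (-|x|)

/-- A two-component Laplace mixture density. -/
def mixL (ε μ₁ μ₂ : ℝ) : ℝ → ℝ := fun x => (1 - ε) * phiL (x - μ₁) + ε * phiL (x - μ₂)

/-- The threshold `ρ(k,n) = k/n + (1 + √(1+2kβ))/(nβ)`. -/
def rhoKn (n k : ℕ) (β : ℝ) : ℝ :=
  ((k : ℝ) / (n : ℝ)) + (1 + Real.sqrt (1 + 2 * (k : ℝ) * β)) / ((n : ℝ) * β)

open ProbabilityTheory

lemma phiG_eq_gaussianPDFReal (a x : ℝ) : phiG (x - a) = gaussianPDFReal a 1 x := by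
  simp [phiG, gaussianPDFReal]

lemma phiG_nonneg (x : ℝ) : 0 ≤ phiG x := by
  unfold phiG; positivity

lemma phiG_le_phiG {x y : ℝ} (hx : 0 ≤ x) (hxy : x ≤ y) : phiG y ≤ phiG x := by
  unfold phiG
  gcongr

lemma pdfMeasure_phiG : pdfMeasure phiG = gaussianReal 0 1 := by
  rw [gaussianReal_of_var_ne_zero 0 one_ne_zero, pdfMeasure]
  congr 1
  ext x
  rw [gaussianPDF, ← phiG_eq_gaussianPDFReal, sub_zero]

lemma pdfMeasure_mixG {ε : ℝ} (hε : ε ∈ Set.Ioo (0 : ℝ) 1) (a b : ℝ) :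
    pdfMeasure (mixG ε a b) =
      ENNReal.ofReal (1 - ε) • gaussianReal a 1 + ENNReal.ofReal ε • gaussianReal b 1 := by
  have h1 : 0 ≤ 1 - ε := by linarith [hε.2]
  rw [gaussianReal_of_var_ne_zero a one_ne_zero, gaussianReal_of_var_ne_zero b one_ne_zero,
    ← withDensity_smul _ (by fun_prop), ← withDensity_smul _ (by fun_prop), pdfMeasure,
    ← withDensity_add_left ((measurable_gaussianPDF a 1).const_smul _)]
  congr 1
  ext x
  simp only [mixG, Pi.add_apply, Pi.smul_apply, smul_eq_mul, gaussianPDF,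
    ← phiG_eq_gaussianPDFReal]
  rw [ENNReal.ofReal_add (mul_nonneg h1 (phiG_nonneg _)) (mul_nonneg hε.1.le (phiG_nonneg _)),
    ENNReal.ofReal_mul h1, ENNReal.ofReal_mul hε.1.le]

lemma isProbabilityMeasure_pdfMeasure_mixG {ε : ℝ} (hε : ε ∈ Set.Ioo (0 : ℝ) 1) (a b : ℝ) :
    IsProbabilityMeasure (pdfMeasure (mixG ε a b)) := by
  constructor
  rw [pdfMeasure_mixG hε]
  simp only [Measure.add_apply, Measure.smul_apply, measure_univ, smul_eq_mul, mul_one]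
  rw [← ENNReal.ofReal_add (by linarith [hε.2]) hε.1.le]
  simp

/-- The upper tail of the standard Gaussian law. -/
def gaussTail (t : ℝ) : ℝ := (gaussianReal 0 1).real (Set.Ioi t)

lemma gaussTail_nonneg (t : ℝ) : 0 ≤ gaussTail t := measureReal_nonneg

lemma gaussTail_anti {s t : ℝ} (h : s ≤ t) : gaussTail t ≤ gaussTail s :=
  measureReal_mono (Set.Ioi_subset_Ioi h)

lemma gaussianReal_real_Ioi (a t : ℝ) : (gaussianReal a 1).real (Set.Ioi t) = gaussTail (t - a) := by
  have h := gaussianReal_map_add_const (μ := 0) (v := 1) a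
  rw [zero_add] at h
  rw [← h, map_measureReal_apply (by fun_prop) measurableSet_Ioi, gaussTail]
  congr 1
  ext x
  simp [sub_lt_iff_lt_add]

lemma gaussianReal_real_Iio (a t : ℝ) : (gaussianReal a 1).real (Set.Iio t) = gaussTail (a - t) := by
  have h := gaussianReal_map_const_sub (μ := 0) (v := 1) a
  rw [sub_zero] at h
  rw [← h, map_measureReal_apply (by fun_prop) measurableSet_Iio, gaussTail]
  congr 1
  ext x
  simp

lemma gaussTail_sub {a b : ℝ} (hab : a ≤ b) :
    gaussTail a - gaussTail b = ∫ x in a..b, phiG x := by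
  have h : (gaussianReal 0 1).real (Set.Ioi a) =
      (gaussianReal 0 1).real (Set.Ioc a b) + (gaussianReal 0 1).real (Set.Ioi b) := by
    rw [← Set.Ioc_union_Ioi_eq_Ioi hab]
    exact measureReal_union (Set.Ioc_disjoint_Ioi le_rfl) measurableSet_Ioi
  rw [gaussTail, gaussTail, h, add_sub_cancel_right, intervalIntegral.integral_of_le hab,
    measureReal_def, gaussianReal_apply_eq_integral 0 one_ne_zero, ENNReal.toReal_ofReal]
  · simp [← phiG_eq_gaussianPDFReal]
  · exact integral_nonneg fun x => gaussianPDFReal_nonneg _ _ _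

lemma continuous_phiG : Continuous phiG := by
  unfold phiG; fun_prop

lemma gaussTail_sub_le {a b : ℝ} (ha : 0 ≤ a) (hab : a ≤ b) :
    gaussTail a - gaussTail b ≤ (b - a) * phiG a := by
  rw [gaussTail_sub hab]
  calc ∫ x in a..b, phiG x ≤ ∫ x in a..b, phiG a :=
        intervalIntegral.integral_mono_on hab (continuous_phiG.intervalIntegrable _ _)
          (by simp) fun x hx => phiG_le_phiG ha hx.1
    _ = _ := by simp

lemma le_gaussTail_sub {a b : ℝ} (ha : 0 ≤ a) (hab : a ≤ b) :
    (b - a) * phiG b ≤ gaussTail a - gaussTail b := by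
  rw [gaussTail_sub hab]
  calc _ = ∫ x in a..b, phiG b := by simp
    _ ≤ ∫ x in a..b, phiG x :=
        intervalIntegral.integral_mono_on hab (by simp)
          (continuous_phiG.intervalIntegrable _ _)
          fun x hx => phiG_le_phiG (ha.trans hx.1) hx.2

lemma phiG_add_one_le_gaussTail {x : ℝ} (hx : 0 ≤ x) : phiG (x + 1) ≤ gaussTail x := by
  have := le_gaussTail_sub hx (by linarith : x ≤ x + 1)
  linarith [gaussTail_nonneg (x + 1)]

lemma gaussTail_le_exp {t : ℝ} (ht : 0 ≤ t) : gaussTail t ≤ Real.exp (-t ^ 2 / 2) := by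
  have h := measure_ge_le_exp_mul_mgf (μ := gaussianReal 0 1) (X := id) t ht
    (by simpa using integrable_exp_mul_gaussianReal t)
  rw [mgf_id_gaussianReal] at h
  refine (measureReal_mono (s₂ := {ω | t ≤ id ω}) fun x hx => (le_of_lt hx : t ≤ x)).trans
    (h.trans ?_)
  rw [← Real.exp_add]
  gcongr
  simp
  linarith

lemma gaussTail_le_phiG {t : ℝ} (ht : 0 ≤ t) : gaussTail t ≤ 3 * phiG t := by
  refine (gaussTail_le_exp ht).trans ?_
  have h : Real.sqrt (2 * Real.pi) ≤ 3 := by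
    rw [Real.sqrt_le_left (by norm_num)]
    linarith [Real.pi_lt_d2]
  have h0 : 0 < Real.sqrt (2 * Real.pi) := by positivity
  rw [phiG, ← mul_assoc]
  refine le_mul_of_one_le_left (Real.exp_nonneg _) ?_
  rw [← div_eq_mul_inv, one_le_div h0]
  exact h

lemma tendsto_gaussTail_atTop : Tendsto gaussTail atTop (nhds 0) := by
  refine squeeze_zero' (Eventually.of_forall gaussTail_nonneg)
    ((eventually_ge_atTop 0).mono fun t ht => gaussTail_le_exp ht) ?_
  refine Real.tendsto_exp_atBot.comp ?_
  have h : Tendsto (fun t : ℝ => t ^ 2) atTop atTop := tendsto_pow_atTop two_ne_zero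
  simp_rw [neg_div]
  exact tendsto_neg_atTop_atBot.comp (h.atTop_div_const two_pos)

lemma gaussTail_zero_pos : 0 < gaussTail 0 := by
  refine lt_of_lt_of_le ?_ (phiG_add_one_le_gaussTail le_rfl)
  unfold phiG; positivity

lemma continuousOn_gaussTail : ContinuousOn gaussTail (Set.Ici 0) := by
  have h : ∀ x ∈ Set.Ici (0 : ℝ), gaussTail x = gaussTail 0 - ∫ y in (0 : ℝ)..x, phiG y := by
    intro x hx
    rw [← gaussTail_sub hx]; ring
  refine ContinuousOn.congr ?_ h
  have : Continuous fun x => ∫ y in (0 : ℝ)..x, phiG y :=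
    intervalIntegral.continuous_primitive (fun a b => continuous_phiG.intervalIntegrable a b) 0
  fun_prop

lemma exists_gaussTail_eq {p : ℝ} (hp0 : 0 < p) (hp : p ≤ gaussTail 0) :
    ∃ t, 0 ≤ t ∧ gaussTail t = p := by
  obtain ⟨T, hT, hT0⟩ := ((tendsto_gaussTail_atTop.eventually_lt_const hp0).and
    (eventually_ge_atTop 0)).exists
  obtain ⟨t, ht, h⟩ := intermediate_value_Icc' hT0
    (continuousOn_gaussTail.mono Set.Icc_subset_Ici_self) ⟨hT.le, hp⟩
  exact ⟨t, ht.1, h⟩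

/-- The number of observations falling in `B`. -/
def countIn {n : ℕ} (B : Set ℝ) (ω : Fin n → ℝ) : ℕ := {i | ω i ∈ B}.ncard

lemma countIn_eq_sum {n : ℕ} (B : Set ℝ) (ω : Fin n → ℝ) :
    (countIn B ω : ℝ) = ∑ i, B.indicator (fun _ => (1 : ℝ)) (ω i) := by
  classical
  rw [countIn, Set.ncard_eq_toFinset_card', Finset.card_eq_sum_ones]
  simp [Set.indicator_apply]

lemma measureReal_abs_countIn_sub_ge_le (n : ℕ) (ν : Measure ℝ) [IsProbabilityMeasure ν]
    {B : Set ℝ} (hB : MeasurableSet B) {c : ℝ} (hc : 0 < c) :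
    (Measure.pi fun _ : Fin n => ν) {ω | c ≤ |(countIn B ω : ℝ) - n * ν.real B|} ≤
      ENNReal.ofReal (n * ν.real B / c ^ 2) := by
  set X : ℝ → ℝ := B.indicator fun _ => (1 : ℝ) with hX
  have hXm : Measurable X := measurable_const.indicator hB
  have hXL : MemLp X 2 ν := by
    refine MemLp.of_bound hXm.aestronglyMeasurable 1 (Eventually.of_forall fun x => ?_)
    by_cases hx : x ∈ B <;> simp [X, hx]
  have hint : ∫ x, X x ∂ν = ν.real B := by
    rw [hX, integral_indicator_const _ hB]; simp
  have hvar : Var[X; ν] ≤ ν.real B := by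
    refine (variance_le_expectation_sq hXm.aestronglyMeasurable).trans_eq ?_
    rw [← hint]
    congr 1
    ext x
    by_cases hx : x ∈ B <;> simp [X, hx]
  have hS : (fun ω : Fin n → ℝ => (countIn B ω : ℝ)) = ∑ i, fun ω => X (ω i) := by
    ext ω
    rw [countIn_eq_sum, Finset.sum_apply]
  have hcomp : ∀ i : Fin n, MemLp (fun ω : Fin n → ℝ => X (ω i)) 2 (Measure.pi fun _ => ν) :=
    fun i => hXL.comp_measurePreserving (measurePreserving_eval (fun _ => ν) i)
  have hV : Var[fun ω : Fin n → ℝ => (countIn B ω : ℝ); Measure.pi fun _ => ν] ≤ n * ν.real B := by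
    rw [hS, variance_sum_pi (X := fun _ => X) fun _ => hXL]
    simpa using mul_le_mul_of_nonneg_left hvar (Nat.cast_nonneg n)
  have hE : (∫ ω : Fin n → ℝ, (countIn B ω : ℝ) ∂(Measure.pi fun _ => ν)) = n * ν.real B := by
    rw [hS]
    rw [integral_congr_ae (Eventually.of_forall fun ω => Finset.sum_apply ω _ _),
      integral_finsetSum _ fun i _ => (hcomp i).integrable (by norm_num)]
    have : ∀ i : Fin n, ∫ ω : Fin n → ℝ, X (ω i) ∂(Measure.pi fun _ => ν) = ν.real B := by
      intro i
      rw [← hint]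
      exact integral_comp_eval (μ := fun _ : Fin n => ν) hXm.aestronglyMeasurable
    simp [this]
  have hL : MemLp (fun ω : Fin n → ℝ => (countIn B ω : ℝ)) 2 (Measure.pi fun _ => ν) := by
    rw [hS]
    exact memLp_finsetSum' _ fun i _ => hcomp i
  have := meas_ge_le_variance_div_sq hL hc
  rw [hE] at this
  exact this.trans (ENNReal.ofReal_le_ofReal (by gcongr))

lemma measure_le_countIn_le (n k : ℕ) (ν : Measure ℝ) [IsProbabilityMeasure ν]
    {B : Set ℝ} (hB : MeasurableSet B) {M A : ℝ} (hA : 0 < A) (hM : n * ν.real B ≤ M)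
    (hk : M + A ≤ k) :
    (Measure.pi fun _ : Fin n => ν) {ω | k ≤ countIn B ω} ≤ ENNReal.ofReal (M / A ^ 2) := by
  refine (measure_mono ?_).trans ((measureReal_abs_countIn_sub_ge_le n ν hB hA).trans
    (ENNReal.ofReal_le_ofReal (by gcongr)))
  intro ω hω
  have : (k : ℝ) ≤ countIn B ω := by exact_mod_cast hω
  refine le_trans ?_ (le_abs_self ((countIn B ω : ℝ) - n * ν.real B))
  linarith

lemma measure_countIn_lt_le (n k : ℕ) (ν : Measure ℝ) [IsProbabilityMeasure ν]
    {B : Set ℝ} (hB : MeasurableSet B) {A : ℝ} (hA : 0 < A) (hM : k + A ≤ n * ν.real B) :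
    (Measure.pi fun _ : Fin n => ν) {ω | countIn B ω < k} ≤
      ENNReal.ofReal ((k + A) / A ^ 2) := by
  set M := n * ν.real B with hMdef
  have hMk : 0 < M - k := by linarith
  refine (measure_mono ?_).trans ((measureReal_abs_countIn_sub_ge_le n ν hB hMk).trans
    (ENNReal.ofReal_le_ofReal ?_))
  · intro ω hω
    have : (countIn B ω : ℝ) ≤ k := by exact_mod_cast (le_of_lt hω)
    refine le_trans ?_ (neg_le_abs ((countIn B ω : ℝ) - M))
    linarith
  · have hk : (0 : ℝ) ≤ k := Nat.cast_nonneg k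
    rw [← hMdef, div_le_div_iff₀ (by positivity) (by positivity)]
    obtain ⟨x, hx⟩ : ∃ x, M = k + A + x := ⟨M - (k + A), by ring⟩
    have hx0 : 0 ≤ x := by linarith
    have e : M - k = A + x := by linarith
    rw [e, hx]
    have h1 : 0 ≤ k * A * x := by positivity
    have h2 : 0 ≤ A * A * x := by positivity
    have h3 : 0 ≤ (k + A) * x ^ 2 := by positivity
    nlinarith

lemma card_le_countIn {n : ℕ} {B : Set ℝ} {ω : Fin n → ℝ} (s : Finset (Fin n))
    (h : ∀ j ∈ s, ω (Tuple.sort ω j) ∈ B) : s.card ≤ countIn B ω := by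
  rw [← Set.ncard_coe_finset, ← Set.ncard_image_of_injective _ (Tuple.sort ω).injective]
  refine Set.ncard_le_ncard ?_ (Set.toFinite _)
  rintro _ ⟨j, hj, rfl⟩
  exact h j hj

lemma countIn_add_countIn_compl {n : ℕ} (B : Set ℝ) (ω : Fin n → ℝ) :
    countIn B ω + countIn Bᶜ ω = n := by
  have h := Set.ncard_add_ncard_compl {i | ω i ∈ B} (Set.toFinite _) (Set.toFinite _)
  rwa [Nat.card_eq_fintype_card, Fintype.card_fin] at h

lemma oStat_eq {n k : ℕ} (ω : Fin n → ℝ) (h1 : 1 ≤ k) (hn : k ≤ n) :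
    oStat k ω = ω (Tuple.sort ω ⟨k - 1, by omega⟩) := by
  rw [oStat, dif_pos ⟨h1, hn⟩]

lemma le_countIn_of_lt_oStat {n k : ℕ} {ω : Fin n → ℝ} {t : ℝ} (h1 : 1 ≤ k) (hn : k ≤ n)
    (h : t < oStat (n - k + 1) ω) : k ≤ countIn (Set.Ioi t) ω := by
  rw [oStat_eq ω (by omega) (by omega)] at h
  have := card_le_countIn (B := Set.Ioi t) (ω := ω)
    (Finset.Ici (⟨n - k + 1 - 1, by omega⟩ : Fin n)) fun j hj =>
      h.trans_le (Tuple.monotone_sort ω (Finset.mem_Ici.1 hj))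
  rw [Fin.card_Ici] at this
  simp only at this
  omega

lemma le_countIn_of_oStat_lt {n k : ℕ} {ω : Fin n → ℝ} {t : ℝ} (h1 : 1 ≤ k) (hn : k ≤ n)
    (h : oStat k ω < t) : k ≤ countIn (Set.Iio t) ω := by
  rw [oStat_eq ω (by omega) (by omega)] at h
  have := card_le_countIn (B := Set.Iio t) (ω := ω)
    (Finset.Iic (⟨k - 1, by omega⟩ : Fin n)) fun j hj =>
      (Tuple.monotone_sort ω (Finset.mem_Iic.1 hj) : ω (Tuple.sort ω j) ≤ _).trans_lt h
  rw [Fin.card_Iic] at this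
  simp only at this
  omega

lemma lt_oStat_of_le_countIn {n k : ℕ} {ω : Fin n → ℝ} {t : ℝ} (h1 : 1 ≤ k) (hn : k ≤ n)
    (h : k ≤ countIn (Set.Ioi t) ω) : t < oStat (n - k + 1) ω := by
  by_contra! hlt
  rw [oStat_eq ω (by omega) (by omega)] at hlt
  have := card_le_countIn (B := Set.Iic t) (ω := ω)
    (Finset.Iic (⟨n - k + 1 - 1, by omega⟩ : Fin n)) fun j hj =>
      (Tuple.monotone_sort ω (Finset.mem_Iic.1 hj) : ω (Tuple.sort ω j) ≤ _).trans hlt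
  rw [Fin.card_Iic] at this
  have hc := countIn_add_countIn_compl (Set.Ioi t) ω
  rw [Set.compl_Ioi] at hc
  simp only at this
  omega

lemma oStat_lt_of_le_countIn {n k : ℕ} {ω : Fin n → ℝ} {t : ℝ} (h1 : 1 ≤ k) (hn : k ≤ n)
    (h : k ≤ countIn (Set.Iio t) ω) : oStat k ω < t := by
  by_contra! hlt
  rw [oStat_eq ω (by omega) (by omega)] at hlt
  have := card_le_countIn (B := Set.Ici t) (ω := ω)
    (Finset.Ici (⟨k - 1, by omega⟩ : Fin n)) fun j hj =>
      hlt.trans (Tuple.monotone_sort ω (Finset.mem_Ici.1 hj))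
  rw [Fin.card_Ici] at this
  have hc := countIn_add_countIn_compl (Set.Iio t) ω
  rw [Set.compl_Iio] at hc
  simp only at this
  omega

lemma spacing_nonneg {n k : ℕ} (ω : Fin n → ℝ) (h1 : 1 ≤ k) (hn : 2 * k ≤ n) :
    0 ≤ spacing k ω := by
  rw [spacing, oStat_eq ω (by omega) (by omega), oStat_eq ω (by omega) (by omega), sub_nonneg]
  exact Tuple.monotone_sort ω (Fin.mk_le_mk.2 (by omega))

lemma mem_Kfin {n k : ℕ} (hn : 2 ≤ n) (hk : k ∈ Kfin n) : 1 ≤ k ∧ 2 * k ≤ n := by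
  simp only [Kfin, Finset.mem_image, Finset.mem_range] at hk
  obtain ⟨j, hj, rfl⟩ := hk
  have h := Nat.pow_le_of_le_log (b := 2) (y := n / 2) (by omega) (Nat.lt_succ_iff.1 hj)
  exact ⟨Nat.one_le_two_pow, by omega⟩

lemma Kfin_nonempty (n : ℕ) : (Kfin n).Nonempty :=
  ⟨1, Finset.mem_image.2 ⟨0, by simp, by simp⟩⟩

instance : IsProbabilityMeasure (pdfMeasure phiG) := by
  rw [pdfMeasure_phiG]; infer_instance

instance (n : ℕ) : IsProbabilityMeasure (sampleMeasure n phiG) := by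
  unfold sampleMeasure; infer_instance

lemma sampleMeasure_spacing_gt_le {n k : ℕ} (h1 : 1 ≤ k) (hn : k ≤ n) {t M A u : ℝ}
    (hA : 0 < A) (hM : n * gaussTail t ≤ M) (hk : M + A ≤ k) (hu : 2 * (M / A ^ 2) ≤ u) :
    sampleMeasure n phiG {ω | spacing k ω > 2 * t} ≤ ENNReal.ofReal u := by
  have hM0 : 0 ≤ M / A ^ 2 := by
    have := mul_nonneg (Nat.cast_nonneg (α := ℝ) n) (gaussTail_nonneg t)
    exact div_nonneg (this.trans hM) (by positivity)
  have hsub : {ω : Fin n → ℝ | spacing k ω > 2 * t} ⊆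
      {ω | k ≤ countIn (Set.Ioi t) ω} ∪ {ω | k ≤ countIn (Set.Iio (-t)) ω} := by
    intro ω hω
    by_cases h : t < oStat (n - k + 1) ω
    · exact Or.inl (le_countIn_of_lt_oStat h1 hn h)
    · refine Or.inr (le_countIn_of_oStat_lt h1 hn ?_)
      simp only [spacing, Set.mem_ofPred_eq] at hω
      linarith
  unfold sampleMeasure
  refine (measure_mono hsub).trans ((measure_union_le _ _).trans ?_)
  refine (add_le_add
    (measure_le_countIn_le n k (pdfMeasure phiG) measurableSet_Ioi hA ?_ hk)
    (measure_le_countIn_le n k (pdfMeasure phiG) measurableSet_Iio hA ?_ hk)).trans ?_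
  · rwa [pdfMeasure_phiG, gaussianReal_real_Ioi, sub_zero]
  · rwa [pdfMeasure_phiG, gaussianReal_real_Iio, zero_sub, neg_neg]
  · rw [← ENNReal.ofReal_add hM0 hM0]
    exact ENNReal.ofReal_le_ofReal (by linarith)

lemma exists_sampleMeasure_spacing_gt_le {n k : ℕ} (h1 : 1 ≤ k) (hn : k ≤ n) {u : ℝ}
    (hu : 0 < u) : ∃ t, sampleMeasure n phiG {ω | spacing k ω > t} ≤ ENNReal.ofReal u := by
  have h : Tendsto (fun t => (n : ℝ) * gaussTail t) atTop (nhds 0) := by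
    simpa using tendsto_gaussTail_atTop.const_mul (n : ℝ)
  obtain ⟨t, ht⟩ := (h.eventually_le_const (show (0 : ℝ) < min (1 / 2) (u / 8) by positivity)).exists
  have hk : (1 : ℝ) ≤ k := by exact_mod_cast h1
  refine ⟨2 * t, sampleMeasure_spacing_gt_le h1 hn (A := 1 / 2) (by norm_num) ht ?_ ?_⟩
  · linarith [min_le_left (1 / 2 : ℝ) (u / 8)]
  · have := min_le_right (1 / 2 : ℝ) (u / 8)
    rw [show (1 / 2 : ℝ) ^ 2 = 1 / 4 by norm_num]
    linarith

lemma bddBelow_sampleMeasure_spacing {n k : ℕ} (h1 : 1 ≤ k) (hn : 2 * k ≤ n) {u : ℝ}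
    (hu : u < 1) :
    BddBelow {t : ℝ | sampleMeasure n phiG {ω | spacing k ω > t} ≤ ENNReal.ofReal u} := by
  refine ⟨0, fun t ht => ?_⟩
  by_contra! h0
  have : {ω : Fin n → ℝ | spacing k ω > t} = Set.univ :=
    Set.eq_univ_of_forall fun ω => h0.trans_le (spacing_nonneg ω h1 hn)
  rw [Set.mem_ofPred_eq, this, measure_univ, ENNReal.one_le_ofReal] at ht
  linarith

lemma sampleMeasure_spacing_gt_quantile_le {n k : ℕ} (h1 : 1 ≤ k) (hn : 2 * k ≤ n) {u : ℝ}
    (hu : 0 < u) :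
    sampleMeasure n phiG {ω | spacing k ω > spacingQuantile n phiG u k} ≤ ENNReal.ofReal u := by
  set q := spacingQuantile n phiG u k with hq
  have hU : {ω : Fin n → ℝ | spacing k ω > q} =
      ⋃ m : ℕ, {ω : Fin n → ℝ | spacing k ω > q + 1 / ((m : ℝ) + 1)} := by
    ext ω
    simp only [Set.mem_ofPred_eq, Set.mem_iUnion]
    constructor
    · intro h
      obtain ⟨m, hm⟩ := exists_nat_one_div_lt (sub_pos.2 h)
      exact ⟨m, by linarith⟩
    · rintro ⟨m, hm⟩
      have : 0 < 1 / ((m : ℝ) + 1) := by positivity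
      linarith
  have hmono : Monotone fun m : ℕ => {ω : Fin n → ℝ | spacing k ω > q + 1 / ((m : ℝ) + 1)} := by
    intro a b hab ω hω
    have : 1 / ((b : ℝ) + 1) ≤ 1 / ((a : ℝ) + 1) := by gcongr
    simp only [Set.mem_ofPred_eq] at hω ⊢
    linarith
  rw [hU, hmono.measure_iUnion]
  refine iSup_le fun m => ?_
  obtain ⟨t, ht, htq⟩ := Real.lt_sInf_add_pos
    (exists_sampleMeasure_spacing_gt_le (n := n) (k := k) h1 (by omega) hu)
    (show (0 : ℝ) < 1 / ((m : ℝ) + 1) by positivity)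
  refine (measure_mono fun ω hω => ?_).trans ht
  exact htq.trans hω

lemma le_alphaN {n : ℕ} (hn : 2 ≤ n) {α : ℝ} (hα : α ∈ Set.Ioo (0 : ℝ) 1) :
    α / (Kfin n).card ≤ alphaN n phiG α := by
  have hc : (1 : ℝ) ≤ (Kfin n).card := by exact_mod_cast (Kfin_nonempty n).card_pos
  have hu : 0 < α / (Kfin n).card := div_pos hα.1 (by linarith)
  refine le_csSup ⟨1, fun u hu => hu.1.2.le⟩ ⟨⟨hu, ?_⟩, ?_⟩
  · exact (div_le_self hα.1.le hc).trans_lt hα.2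
  · have hU : {ω : Fin n → ℝ | ∃ k ∈ Kfin n,
        spacing k ω > spacingQuantile n phiG (α / (Kfin n).card) k} =
        ⋃ k ∈ Kfin n, {ω | spacing k ω > spacingQuantile n phiG (α / (Kfin n).card) k} := by
      ext ω; simp
    rw [hU]
    refine (measure_biUnion_finset_le _ _).trans ((Finset.sum_le_sum fun k hk =>
      sampleMeasure_spacing_gt_quantile_le (mem_Kfin hn hk).1 (mem_Kfin hn hk).2 hu).trans ?_)
    rw [Finset.sum_const, nsmul_eq_mul, ← ENNReal.ofReal_natCast, ← ENNReal.ofReal_mul (by positivity),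
      mul_div_cancel₀ _ (by positivity)]

lemma alphaN_le_one (n : ℕ) (α : ℝ) : alphaN n phiG α ≤ 1 :=
  Real.sSup_le (fun _ hu => hu.1.2.le) zero_le_one

lemma spacingQuantile_alphaN_le {n k : ℕ} (hn : 2 ≤ n) (hk : k ∈ Kfin n) {α : ℝ}
    (hα : α ∈ Set.Ioo (0 : ℝ) 1) {t : ℝ} (ht : 0 ≤ t)
    (h : sampleMeasure n phiG {ω | spacing k ω > t} ≤ ENNReal.ofReal (α / (Kfin n).card)) :
    spacingQuantile n phiG (alphaN n phiG α) k ≤ t := by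
  obtain ⟨h1, h2⟩ := mem_Kfin hn hk
  rcases (alphaN_le_one n α).lt_or_eq with h3 | h3
  · exact csInf_le (bddBelow_sampleMeasure_spacing h1 h2 h3)
      (h.trans (ENNReal.ofReal_le_ofReal (le_alphaN hn hα)))
  · have : {t : ℝ | sampleMeasure n phiG {ω | spacing k ω > t} ≤ ENNReal.ofReal 1} = Set.univ :=
      Set.eq_univ_of_forall fun t => by simpa using prob_le_one
    rw [spacingQuantile, h3, this, Real.sInf_univ]
    exact ht

/-- A finite-sample bound on the type II error, for two-component Gaussian mixtures. -/
lemma sampleMeasure_compl_psiReject_le {n k : ℕ} (hn : 2 ≤ n) (hk : k ∈ Kfin n) {α β : ℝ}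
    (hα : α ∈ Set.Ioo (0 : ℝ) 1) {ε : ℝ} (hε : ε ∈ Set.Ioo (0 : ℝ) 1) {μ τ A t s v : ℝ}
    (hA : 0 < A) (ht : 0 ≤ t) (hst : s + v = 2 * t)
    (hH0 : n * gaussTail t ≤ k - A) (hu : 2 * (k / A ^ 2) ≤ α / (Kfin n).card)
    (hs : k + A ≤ n * ((1 - ε) * gaussTail s))
    (hv : k + A ≤ n * ((1 - ε) * gaussTail v + ε * gaussTail (v - τ)))
    (hβ : 2 * ((k + A) / A ^ 2) ≤ β) :
    sampleMeasure n (mixG ε μ (μ + τ)) (psiReject n phiG α)ᶜ ≤ ENNReal.ofReal β := by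
  obtain ⟨h1, h2⟩ := mem_Kfin hn hk
  have hq : spacingQuantile n phiG (alphaN n phiG α) k ≤ 2 * t := by
    refine spacingQuantile_alphaN_le hn hk hα (by linarith)
      (sampleMeasure_spacing_gt_le h1 (by omega) hA hH0 (by linarith) (le_trans ?_ hu))
    gcongr
    linarith
  have := isProbabilityMeasure_pdfMeasure_mixG hε μ (μ + τ)
  have hreal : ∀ B, (pdfMeasure (mixG ε μ (μ + τ))).real B =
      (1 - ε) * (gaussianReal μ 1).real B + ε * (gaussianReal (μ + τ) 1).real B := by
    intro B
    have hfin : ∀ c m : ℝ, (ENNReal.ofReal c • gaussianReal m 1) B ≠ ⊤ := fun c m =>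
      ENNReal.mul_ne_top ENNReal.ofReal_ne_top (measure_ne_top _ _)
    rw [pdfMeasure_mixG hε, measureReal_add_apply (hfin _ _) (hfin _ _), measureReal_ennreal_smul_apply,
      measureReal_ennreal_smul_apply, ENNReal.toReal_ofReal (by linarith [hε.2]),
      ENNReal.toReal_ofReal hε.1.le]
  have hsub : (psiReject n phiG α)ᶜ ⊆ {ω | countIn (Set.Ioi (μ + v)) ω < k} ∪
      {ω | countIn (Set.Iio (μ - s)) ω < k} := by
    intro ω hω
    by_contra hcon
    simp only [Set.mem_union, Set.mem_ofPred_eq, not_or, not_lt] at hcon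
    have hhi := lt_oStat_of_le_countIn h1 (by omega) hcon.1
    have hlo := oStat_lt_of_le_countIn h1 (by omega) hcon.2
    refine hω ⟨k, hk, ?_⟩
    rw [spacing]
    linarith
  have hnn : 0 ≤ (k + A) / A ^ 2 := by positivity
  unfold sampleMeasure
  refine (measure_mono hsub).trans ((measure_union_le _ _).trans ?_)
  refine (add_le_add
    (measure_countIn_lt_le n k (pdfMeasure (mixG ε μ (μ + τ))) measurableSet_Ioi hA ?_)
    (measure_countIn_lt_le n k (pdfMeasure (mixG ε μ (μ + τ))) measurableSet_Iio hA ?_)).trans ?_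
  · rw [hreal, gaussianReal_real_Ioi, gaussianReal_real_Ioi]
    rwa [add_sub_cancel_left, add_sub_add_left_eq_sub]
  · rw [hreal, gaussianReal_real_Iio, gaussianReal_real_Iio, sub_sub_cancel]
    refine hs.trans ?_
    gcongr
    linarith [mul_nonneg hε.1.le (gaussTail_nonneg (μ + τ - (μ - s)))]
  · rw [← ENNReal.ofReal_add hnn hnn]
    exact ENNReal.ofReal_le_ofReal (by linarith)

lemma sampleMeasure_compl_psiReject_le_of_signal {n k : ℕ} (hn : 2 ≤ n) (hk : k ∈ Kfin n)
    {α β : ℝ} (hα : α ∈ Set.Ioo (0 : ℝ) 1) {ε : ℝ} (hε : ε ∈ Set.Ioo (0 : ℝ) 1) {μ τ A y : ℝ}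
    (hA : 0 < A) (hkA : 10 * A ≤ k) (h0 : k + 2 * A ≤ n * gaussTail 0)
    (hεA : ε * (k + 2 * A) ≤ A) (hy : 1 ≤ y)
    (hty : ∀ t, 0 ≤ t → (k / 2 : ℝ) / n ≤ Real.exp (-t ^ 2 / 2) → t + 2 - τ ≤ y)
    (hsig : 6 * A ≤ n * (ε * phiG y)) (hu : 2 * (k / A ^ 2) ≤ α / (Kfin n).card)
    (hβ : 4 * (k / A ^ 2) ≤ β) :
    sampleMeasure n (mixG ε μ (μ + τ)) (psiReject n phiG α)ᶜ ≤ ENNReal.ofReal β := by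
  have hn0 : (0 : ℝ) < n := by positivity
  obtain ⟨t, ht, hteq⟩ := exists_gaussTail_eq (p := (k - A) / n)
    (div_pos (by linarith) hn0) (by rw [div_le_iff₀' hn0]; linarith)
  obtain ⟨s, hs, hseq⟩ := exists_gaussTail_eq (p := (k + 2 * A) / n)
    (div_pos (by linarith) hn0) (by rwa [div_le_iff₀' hn0])
  have ht' : n * gaussTail t = k - A := by rw [hteq]; field_simp
  have hs' : n * gaussTail s = k + 2 * A := by rw [hseq]; field_simp
  have hst : s ≤ t := by
    by_contra! h
    have := mul_le_mul_of_nonneg_left (gaussTail_anti h.le) hn0.le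
    linarith
  have hd : n * ((t - s) * phiG t) ≤ 3 * A := by
    have := mul_le_mul_of_nonneg_left (le_gaussTail_sub hs hst) hn0.le
    linarith
  have hφ : k - A ≤ n * (3 * phiG t) := by
    rw [← ht']
    exact mul_le_mul_of_nonneg_left (gaussTail_le_phiG ht) hn0.le
  have hd1 : t - s ≤ 1 := by
    have hpos : 0 < n * phiG t := by linarith
    have h : (t - s) * (n * phiG t) ≤ 1 * (n * phiG t) := by linarith
    exact le_of_mul_le_mul_right h hpos
  have hv : k - 4 * A ≤ n * gaussTail (2 * t - s) := by
    have := mul_le_mul_of_nonneg_left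
      (gaussTail_sub_le ht (by linarith : t ≤ 2 * t - s)) hn0.le
    rw [show 2 * t - s - t = t - s by ring] at this
    linarith
  have hyv : phiG y ≤ gaussTail (2 * t - s - τ) := by
    have h1 := hty t ht ((gaussTail_le_exp ht).trans' (by rw [hteq]; gcongr; linarith))
    have h2 := phiG_add_one_le_gaussTail (x := y - 1) (by linarith)
    rw [sub_add_cancel] at h2
    exact h2.trans (gaussTail_anti (by linarith))
  refine sampleMeasure_compl_psiReject_le hn hk hα hε hA ht
    (by ring : s + (2 * t - s) = 2 * t) ht'.le hu ?_ ?_ (le_trans ?_ hβ)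
  · calc (k + A : ℝ) ≤ (1 - ε) * (k + 2 * A) := by linarith
      _ = _ := by rw [← hs']; ring
  · have h1 : (1 - ε) * (k - 4 * A) ≤ (1 - ε) * (n * gaussTail (2 * t - s)) :=
      mul_le_mul_of_nonneg_left hv (by linarith [hε.2])
    have h2 : n * (ε * phiG y) ≤ n * (ε * gaussTail (2 * t - s - τ)) := by
      have := hε.1.le
      gcongr
    have h3 : 0 ≤ ε * A := mul_nonneg hε.1.le hA.le
    linarith
  · rw [show (4 : ℝ) * (k / A ^ 2) = 2 * ((2 * k) / A ^ 2) by ring]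
    gcongr
    linarith

lemma exists_sparsity_exponent {δ r : ℝ} (hδ : 1 / 2 < δ) (hδ1 : δ < 1) (hr0 : 0 < r)
    (hr1 : r < 1) (h1 : δ < 3 / 4 → r > δ - 1 / 2)
    (h2 : 3 / 4 ≤ δ → r > (1 - Real.sqrt (1 - δ)) ^ 2) :
    ∃ s η, Real.sqrt r < s ∧ s < 1 ∧ 0 < η ∧
      (1 - s ^ 2) / 2 < 1 - δ - (s - Real.sqrt r + η) ^ 2 := by
  set ρ := Real.sqrt r with hρ
  have hρ0 : 0 < ρ := Real.sqrt_pos.2 hr0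
  have hρr : ρ ^ 2 = r := Real.sq_sqrt hr0.le
  have hρ1 : ρ < 1 := by nlinarith
  have main : ∃ s, ρ < s ∧ s < 1 ∧ (1 - s ^ 2) / 2 < 1 - δ - (s - ρ) ^ 2 := by
    by_cases hq : ρ < 1 / 2
    · have hδ' : δ < 3 / 4 := by
        by_contra! h
        have h3 := h2 h
        have h4 : Real.sqrt (1 - δ) ≤ 1 / 2 := by
          rw [Real.sqrt_le_left (by norm_num)]; linarith
        nlinarith
      have := h1 hδ'
      exact ⟨2 * ρ, by linarith, by linarith, by nlinarith⟩
    · push Not at hq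
      have hone : (1 - ρ) ^ 2 < 1 - δ := by
        rcases lt_or_ge δ (3 / 4) with h | h
        · nlinarith
        · have h3 := h2 h
          have h5 : Real.sqrt (1 - δ) ^ 2 = 1 - δ := Real.sq_sqrt (by linarith)
          have h6 := Real.sqrt_nonneg (1 - δ)
          have h7 : Real.sqrt (1 - δ) < 1 := by
            rw [Real.sqrt_lt' one_pos]; linarith
          have h8 : 1 - Real.sqrt (1 - δ) < ρ := by
            rw [← hρr] at h3
            exact lt_of_pow_lt_pow_left₀ 2 hρ0.le h3
          nlinarith
      have hc : ContinuousAt (fun s : ℝ => 1 - δ - (s - ρ) ^ 2 - (1 - s ^ 2) / 2) 1 := by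
        fun_prop
      have h0 := hc.eventually_const_lt (u := 0) (by norm_num; linarith)
      have h0' := (h0.filter_mono (nhdsWithin_le_nhds (s := Set.Iio 1))).and
        (Ioo_mem_nhdsLT hρ1)
      obtain ⟨s, hs, hs1⟩ := h0'.exists
      exact ⟨s, hs1.1, hs1.2, by linarith⟩
  obtain ⟨s, hs, hs1, h⟩ := main
  have hc : ContinuousAt (fun η : ℝ => 1 - δ - (s - ρ + η) ^ 2) 0 := by fun_prop
  have h0 := hc.eventually_const_lt (u := (1 - s ^ 2) / 2) (by simpa using h)
  have h0' := (h0.filter_mono (nhdsWithin_le_nhds (s := Set.Ioi 0))).and self_mem_nhdsWithin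
  obtain ⟨η, hη, hη0⟩ := h0'.exists
  exact ⟨s, η, hs, hs1, hη0, hη⟩

/-- The largest power of two that is at most `x`, for `1 ≤ x`. -/
def powTwoFloor (x : ℝ) : ℕ := 2 ^ Nat.log 2 ⌊x⌋₊

lemma powTwoFloor_le {x : ℝ} (hx : 1 ≤ x) : (powTwoFloor x : ℝ) ≤ x := by
  have h : powTwoFloor x ≤ ⌊x⌋₊ := Nat.pow_log_le_self 2 (Nat.floor_pos.2 hx).ne'
  exact (Nat.cast_le.2 h).trans (Nat.floor_le (by linarith))

lemma le_powTwoFloor (x : ℝ) : x / 4 ≤ powTwoFloor x := by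
  have h : ⌊x⌋₊ < 2 * powTwoFloor x := by
    rw [powTwoFloor, mul_comm, ← pow_succ]
    exact Nat.lt_pow_succ_log_self one_lt_two _
  have h1 : (⌊x⌋₊ : ℝ) + 1 ≤ 2 * powTwoFloor x := by exact_mod_cast h
  linarith [Nat.lt_floor_add_one x]

lemma powTwoFloor_mem_Kfin {n : ℕ} {x : ℝ} (hx : x ≤ n / 2) : powTwoFloor x ∈ Kfin n := by
  refine Finset.mem_image.2 ⟨Nat.log 2 ⌊x⌋₊, Finset.mem_range.2 (Nat.lt_succ_iff.2 ?_), rfl⟩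
  refine Nat.log_mono_right ?_
  have h : ⌊x⌋₊ ≤ ⌊(n : ℝ) / 2⌋₊ := Nat.floor_le_floor hx
  rwa [Nat.floor_div_ofNat, Nat.floor_natCast] at h

lemma card_Kfin_le {n : ℕ} (hn : 2 ≤ n) : ((Kfin n).card : ℝ) ≤ 2 * Real.log n := by
  have h : (Kfin n).card ≤ Nat.log 2 n := by
    refine (Finset.card_image_le).trans ?_
    rw [Finset.card_range, Nat.log_div_base]
    have := Nat.log_pos one_lt_two hn
    omega
  have h1 : ((Nat.log 2 n : ℕ) : ℝ) ≤ Real.logb 2 n := by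
    have := Real.natLog_le_logb n 2
    exact_mod_cast this
  have h2 : Real.logb 2 n ≤ 2 * Real.log n := by
    have hl : 0 ≤ Real.log n := Real.log_natCast_nonneg n
    rw [Real.logb, div_le_iff₀ (by positivity)]
    nlinarith [Real.log_two_gt_d9]
  exact (Nat.cast_le.2 h).trans (h1.trans h2)

lemma eventually_mul_log_le_rpow (C : ℝ) {p : ℝ} (hp : 0 < p) :
    ∀ᶠ n : ℕ in atTop, C * Real.log n ≤ (n : ℝ) ^ p := by
  have h := ((isLittleO_log_rpow_atTop hp).const_mul_left C).bound one_pos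
  filter_upwards [tendsto_natCast_atTop_atTop.eventually h] with n hn
  rw [one_mul, Real.norm_of_nonneg (Real.rpow_nonneg n.cast_nonneg p)] at hn
  exact (Real.le_norm_self _).trans hn

/-- the spacing test `Ψ_α` is powerful in the sparse Gaussian regime
above the detection boundary (Theorem `sparse:statord`). -/
theorem stmt4 (α β δ r : ℝ)
    (hα : α ∈ Set.Ioo (0:ℝ) 1) (hβ : β ∈ Set.Ioo (0:ℝ) (1 - α))
    (hδ : 1 / 2 < δ) (hδ1 : δ < 1) (hr0 : 0 < r) (hr1 : r < 1)
    (hrstar1 : 1 / 2 < δ → δ < 3 / 4 → r > δ - 1 / 2)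
    (hrstar2 : 3 / 4 ≤ δ → r > (1 - Real.sqrt (1 - δ)) ^ 2)
    (ε τ μ₁ : ℕ → ℝ)
    (hε : ∀ n, ε n ∈ Set.Ioo (0:ℝ) 1) (hτ : ∀ n, 0 < τ n)
    (hεlim : Filter.Tendsto (fun n : ℕ => ε n * (n : ℝ) ^ δ) Filter.atTop (nhds 1))
    (hτlim : Filter.Tendsto (fun n : ℕ => τ n / Real.sqrt (2 * r * Real.log (n : ℝ)))
      Filter.atTop (nhds 1)) :
    ∀ᶠ n : ℕ in Filter.atTop,
      sampleMeasure n (mixG (ε n) (μ₁ n) (μ₁ n + τ n)) (psiReject n phiG α)ᶜ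
        ≤ ENNReal.ofReal β := by
  obtain ⟨s, η, hρs, hs1, hη, hexp⟩ :=
    exists_sparsity_exponent hδ hδ1 hr0 hr1 (hrstar1 hδ) hrstar2
  set ρ := Real.sqrt r with hρ
  have hρ0 : 0 < ρ := Real.sqrt_pos.2 hr0
  have hs0 : 0 < s := hρ0.trans hρs
  set e := s - ρ + η with he
  have he0 : 0 < e := by linarith
  set κ := 1 - s ^ 2 with hκ
  have hκ0 : 0 < κ := by nlinarith
  have hκ1 : 0 < 1 - κ := by rw [hκ]; nlinarith
  have hlog : Tendsto (fun n : ℕ => Real.log (n : ℝ)) atTop atTop :=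
    Real.tendsto_log_atTop.comp tendsto_natCast_atTop_atTop
  have hsqrt : Tendsto (fun n : ℕ => Real.sqrt (2 * Real.log (n : ℝ))) atTop atTop :=
    Real.tendsto_sqrt_atTop.comp (hlog.const_mul_atTop two_pos)
  have hpow : Tendsto (fun n : ℕ => (n : ℝ) ^ (1 - κ)) atTop atTop :=
    (tendsto_rpow_atTop hκ1).comp tendsto_natCast_atTop_atTop
  filter_upwards [eventually_ge_atTop 2, hlog.eventually_ge_atTop 4,
    hlog.eventually_ge_atTop (4 / α), hlog.eventually_ge_atTop (4 / β),
    hsqrt.eventually_ge_atTop (10 / η), hsqrt.eventually_ge_atTop (1 / e),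
    hpow.eventually_ge_atTop (2 / gaussTail 0), hpow.eventually_ge_atTop 2,
    eventually_mul_log_le_rpow 20 (half_pos hκ0),
    eventually_mul_log_le_rpow 36 (sub_pos.2 hexp),
    hεlim.eventually_const_le (show (1 / 2 : ℝ) < 1 by norm_num),
    hεlim.eventually_le_const (show (1 : ℝ) < 2 by norm_num),
    hτlim.eventually_const_le (show 1 - η / (2 * ρ) < 1 by
      have : 0 < η / (2 * ρ) := by positivity
      linarith)] with n hn hL4 hLα hLβ hSη hSe hnT hn2 hLκ hLe hεlo hεhi hτlo
  have hn1 : (1 : ℝ) ≤ n := by exact_mod_cast (by omega : 1 ≤ n)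
  have hn0 : (0 : ℝ) < n := by linarith
  set L := Real.log (n : ℝ) with hLdef
  set S := Real.sqrt (2 * L) with hSdef
  have hL0 : 0 < L := by linarith
  have hS0 : 0 < S := Real.sqrt_pos.2 (by linarith)
  have hSsq : S ^ 2 = 2 * L := Real.sq_sqrt (by linarith)
  have hx1 : 1 ≤ (n : ℝ) ^ κ := Real.one_le_rpow hn1 hκ0.le
  have hxn : (n : ℝ) ^ κ * (n : ℝ) ^ (1 - κ) = n := by
    rw [← Real.rpow_add hn0, add_sub_cancel, Real.rpow_one]
  set x := (n : ℝ) ^ κ with hx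
  have hxhalf : (n : ℝ) ^ (κ / 2) = Real.sqrt x := by
    rw [hx, Real.sqrt_eq_rpow, ← Real.rpow_mul hn0.le, div_eq_mul_one_div]
  set k := powTwoFloor x with hkdef
  have hkx : (k : ℝ) ≤ x := powTwoFloor_le hx1
  have hxk : x / 4 ≤ k := le_powTwoFloor x
  have hk0 : (0 : ℝ) < k := by linarith
  set R := Real.sqrt (k : ℝ) with hR
  have hR0 : 0 < R := Real.sqrt_pos.2 hk0
  have hRsq : R ^ 2 = k := Real.sq_sqrt hk0.le
  have hRx : R ≤ Real.sqrt x := Real.sqrt_le_sqrt hkx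
  have hxR : Real.sqrt x ≤ 2 * R := by
    rw [Real.sqrt_le_left (by positivity), mul_pow, hRsq]
    linarith
  have hRL : 10 * L ≤ R := by linarith
  have hkA2 : (k : ℝ) / (R * L) ^ 2 = 1 / L ^ 2 := by
    rw [mul_pow, hRsq]
    field_simp
  have hkA : 10 * (R * L) ≤ k := by
    have := mul_le_mul_of_nonneg_left hRL hR0.le
    rw [← hRsq]
    linarith
  have hxhalf_n : 2 * x ≤ n := by
    have := mul_le_mul_of_nonneg_left hn2 (zero_le_one.trans hx1)
    linarith
  have hε0 := (hε n).1
  refine sampleMeasure_compl_psiReject_le_of_signal (k := k) (A := R * L) (y := e * S) hn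
    (powTwoFloor_mem_Kfin (by linarith)) hα (hε n) (by positivity) hkA ?_ ?_ ?_ ?_ ?_ ?_ ?_
  · rw [div_le_iff₀ gaussTail_zero_pos] at hnT
    have : x * 2 ≤ x * ((n : ℝ) ^ (1 - κ) * gaussTail 0) := by gcongr
    rw [← mul_assoc, hxn] at this
    linarith
  · have h1 : Real.sqrt n ≤ (n : ℝ) ^ δ := by
      rw [Real.sqrt_eq_rpow]
      exact Real.rpow_le_rpow_of_exponent_le hn1 hδ.le
    have h2 : ε n * Real.sqrt n ≤ 2 := (mul_le_mul_of_nonneg_left h1 hε0.le).trans hεhi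
    have h3 : R ≤ Real.sqrt n := Real.sqrt_le_sqrt (by linarith)
    have h4 : ε n * R ≤ 2 := (mul_le_mul_of_nonneg_left h3 hε0.le).trans h2
    calc ε n * (k + 2 * (R * L)) ≤ ε n * (2 * k) := by gcongr; linarith
      _ = 2 * R * (ε n * R) := by rw [← hRsq]; ring
      _ ≤ 2 * R * 2 := by gcongr
      _ = R * 4 := by ring
      _ ≤ R * L := by gcongr
  · rwa [div_le_iff₀' he0] at hSe
  · intro t ht h
    have h1 : x / 8 / n ≤ Real.exp (-t ^ 2 / 2) := le_trans (by gcongr ?_ / _; linarith) h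
    rw [← Real.log_le_iff_le_exp (by positivity), Real.log_div (by positivity) hn0.ne',
      Real.log_div (by positivity) (by norm_num), hx, Real.log_rpow hn0,
      show (8 : ℝ) = 2 ^ 3 by norm_num, Real.log_pow] at h1
    have h2 := Real.log_two_lt_d9
    push_cast at h1
    have h3 : t ^ 2 ≤ (s * S + 3) ^ 2 := by
      have : 0 ≤ s * S := by positivity
      have h4 : (s * S) ^ 2 = (1 - κ) * (2 * L) := by rw [mul_pow, hSsq, hκ]; ring
      rw [add_sq, h4]
      linarith
    have h4 : t ≤ s * S + 3 := le_of_sq_le_sq h3 (by positivity)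
    have h5 : (ρ - η / 2) * S ≤ τ n := by
      have h6 : Real.sqrt (2 * r * L) = ρ * S := by
        rw [show 2 * r * L = r * (2 * L) by ring, Real.sqrt_mul hr0.le]
      rw [h6, le_div_iff₀ (by positivity)] at hτlo
      refine le_trans (le_of_eq ?_) hτlo
      field_simp
    have h7 : 10 ≤ η * S := by rwa [div_le_iff₀' hη] at hSη
    rw [he]
    linarith
  · have h1 : 1 / 3 ≤ (Real.sqrt (2 * Real.pi))⁻¹ := by
      rw [← one_div]
      refine one_div_le_one_div_of_le (by positivity) ?_
      rw [Real.sqrt_le_left (by norm_num)]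
      linarith [Real.pi_lt_d2]
    have h2 : 1 / 3 * (n : ℝ) ^ (-e ^ 2) ≤ phiG (e * S) := by
      rw [phiG, mul_pow, hSsq, Real.rpow_def_of_pos hn0, ← hLdef,
        show -(e ^ 2 * (2 * L)) / 2 = L * -e ^ 2 by ring]
      gcongr
    have h3 : 1 / 2 * (n : ℝ) ^ (-δ) ≤ ε n := by
      rw [Real.rpow_neg hn0.le, ← div_eq_mul_inv, div_le_iff₀ (by positivity)]
      exact hεlo
    have h4 : (n : ℝ) ^ (κ / 2) * (n : ℝ) ^ (1 - δ - e ^ 2 - κ / 2) =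
        n * ((n : ℝ) ^ (-δ) * (n : ℝ) ^ (-e ^ 2)) := by
      nth_rewrite 3 [← Real.rpow_one (n : ℝ)]
      rw [← Real.rpow_add hn0, ← Real.rpow_add hn0, ← Real.rpow_add hn0]
      congr 1; ring
    calc 6 * (R * L) ≤ 6 * ((n : ℝ) ^ (κ / 2) * L) := by rw [hxhalf]; gcongr
      _ = 1 / 6 * ((n : ℝ) ^ (κ / 2) * (36 * L)) := by ring
      _ ≤ 1 / 6 * ((n : ℝ) ^ (κ / 2) * (n : ℝ) ^ (1 - δ - e ^ 2 - κ / 2)) := by gcongr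
      _ = n * (1 / 2 * (n : ℝ) ^ (-δ) * (1 / 3 * (n : ℝ) ^ (-e ^ 2))) := by rw [h4]; ring
      _ ≤ n * (ε n * phiG (e * S)) := by gcongr
  · have hc := card_Kfin_le hn
    have hc0 : (0 : ℝ) < (Kfin n).card := by exact_mod_cast (Kfin_nonempty n).card_pos
    rw [div_le_iff₀' hα.1] at hLα
    rw [hkA2]
    calc 2 * (1 / L ^ 2) = 4 / (L * (2 * L)) := by field_simp; norm_num
      _ ≤ α * L / (L * (2 * L)) := by gcongr
      _ = α / (2 * L) := by field_simp
      _ ≤ _ := by gcongr; exact hα.1.le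
  · rw [div_le_iff₀' hβ.1] at hLβ
    rw [hkA2, mul_one_div, div_le_iff₀ (by positivity)]
    calc (4 : ℝ) = 4 * 1 := (mul_one 4).symm
      _ ≤ β * L * L := mul_le_mul hLβ (by linarith) one_pos.le (by linarith)
      _ = β * L ^ 2 := by ring
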